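/- Let m > 0 and e be real constants and let K : ℝ³ × ℝ³ → ℝ be a symmetric kernel of class C¹. Let Π be a momentum one-form whose six component functions are smooth and compactly supported, let f = Σ_i (∂Π_i/∂p_i − ∂Πⁱ/∂q_i) be its plasma density, and define φ_f(q) = e·∫ K(q, q')·f(z') dμ(z') and h_f(z) = |p|²/(2m) + (e/2)·φ_f(q). Then the density form and the momentum form of the Lie–Poisson Hamiltonian agree: ∫ (|p|²/(2m))·f(z) dμ(z) + (e²/2)·∬ f(z)·K(q, q')·f(z') dμ(z) dμ(z') = ∫ Σ_i ( Πⁱ(z)·∂h_f/∂q_i(z) − Π_i(z)·∂h_f/∂p_i(z) ) dμ(z). -/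

import Mathlib

open MeasureTheory

noncomputable section

/-- Position/momentum 3-space. -/
abbrev V3 : Type := Fin 3 → ℝ

/-- Phase space `ℝ³ × ℝ³` with coordinates `z = (q, p)`. -/
abbrev Phase : Type := V3 × V3

/-- Partial derivative in the `i`-th position variable `q i`. -/
def pq (i : Fin 3) (F : Phase → ℝ) (z : Phase) : ℝ :=
  deriv (fun s => F (Function.update z.1 i s, z.2)) (z.1 i)

/-- Partial derivative in the `i`-th momentum variable `p i`. -/
def pp (i : Fin 3) (F : Phase → ℝ) (z : Phase) : ℝ :=
  deriv (fun s => F (z.1, Function.update z.2 i s)) (z.2 i)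

/-- Partial derivative of a function on `ℝ³`. -/
def dq3 (i : Fin 3) (g : V3 → ℝ) (q : V3) : ℝ :=
  deriv (fun s => g (Function.update q i s)) (q i)

/-- Action of the Hamiltonian vector field of `a` on the function `F`:
`X_a(F) = Σᵢ (∂a/∂pᵢ ∂F/∂qᵢ − ∂a/∂qᵢ ∂F/∂pᵢ)`. -/
def Xact (a F : Phase → ℝ) (z : Phase) : ℝ :=
  ∑ i : Fin 3, (pp i a z * pq i F z - pq i a z * pp i F z)

/-- The integral over a compact set of a function which is continuously differentiable in the
parameter is continuously differentiable. -/
theorem contDiff_one_setIntegral_of_isCompact {H Y E : Type*}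
    [NormedAddCommGroup H] [NormedSpace ℝ H] [ProperSpace H]
    [TopologicalSpace Y] [T2Space Y] [SecondCountableTopology Y]
    [MeasurableSpace Y] [OpensMeasurableSpace Y]
    [NormedAddCommGroup E] [NormedSpace ℝ E]
    {μ : Measure Y} [IsLocallyFiniteMeasure μ]
    {F : H → Y → E} {F' : H → Y → H →L[ℝ] E}
    (hF : Continuous F.uncurry) (hF' : Continuous F'.uncurry)
    (hd : ∀ x y, HasFDerivAt (fun x => F x y) (F' x y) x)
    {k : Set Y} (hk : IsCompact k) :
    ContDiff ℝ 1 (fun x => ∫ y in k, F x y ∂μ) := by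
  have hFx : ∀ x, Continuous (F x) := fun x => hF.comp (by fun_prop : Continuous fun y => (x, y))
  have hFx' : ∀ x, Continuous (F' x) := fun x => hF'.comp (by fun_prop : Continuous fun y => (x, y))
  have key : ∀ x₀, HasFDerivAt (fun x => ∫ y in k, F x y ∂μ) (∫ y in k, F' x₀ y ∂μ) x₀ := by
    intro x₀
    obtain ⟨C, hC⟩ := ((isCompact_closedBall x₀ 1).prod hk).exists_bound_of_continuousOn
      hF'.continuousOn
    refine hasFDerivAt_integral_of_dominated_of_fderiv_le (bound := fun _ => C)
      (F' := F') (Metric.closedBall_mem_nhds x₀ one_pos) ?_ ?_ ?_ ?_ ?_ ?_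
    · exact Filter.Eventually.of_forall fun x => (hFx x).aestronglyMeasurable
    · exact (hFx x₀).continuousOn.integrableOn_compact hk
    · exact (hFx' x₀).aestronglyMeasurable
    · filter_upwards [ae_restrict_mem hk.measurableSet] with y hy x hx
      exact hC (x, y) ⟨hx, hy⟩
    · exact continuousOn_const.integrableOn_compact hk
    · exact Filter.Eventually.of_forall fun y x _ => hd x y
  rw [contDiff_one_iff_fderiv]
  refine ⟨fun x => (key x).differentiableAt, ?_⟩
  rw [funext fun x => (key x).fderiv]
  exact continuous_parametric_integral_of_continuous hF' hk

/-- The potential generated by a continuous compactly supported density through a `C¹` kernel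
is `C¹`. -/
theorem contDiff_one_integral_kernel_mul {K : V3 → V3 → ℝ}
    (hK : ContDiff ℝ 1 (fun w : V3 × V3 => K w.1 w.2)) {f : Phase → ℝ}
    (hf : Continuous f) (hc : HasCompactSupport f) :
    ContDiff ℝ 1 (fun q => ∫ z : Phase, K q z.1 * f z) := by
  have hfd : Continuous (fderiv ℝ fun w : V3 × V3 => K w.1 w.2) := hK.continuous_fderiv one_ne_zero
  have hcont : Continuous fun w : V3 × V3 => K w.1 w.2 := hK.continuous
  have hset : ∀ q, ∫ z : Phase, K q z.1 * f z = ∫ z in tsupport f, K q z.1 * f z := fun q =>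
    (setIntegral_eq_integral_of_forall_compl_eq_zero fun z hz => by
      rw [image_eq_zero_of_notMem_tsupport hz, mul_zero]).symm
  simp_rw [hset]
  refine contDiff_one_setIntegral_of_isCompact (F := fun q z => K q z.1 * f z)
    (F' := fun q z => f z • (fderiv ℝ (fun w : V3 × V3 => K w.1 w.2) (q, z.1)).comp
      (ContinuousLinearMap.inl ℝ V3 V3)) ?_ ?_ ?_ hc
  · exact (hcont.comp (by fun_prop : Continuous fun w : V3 × Phase => (w.1, w.2.1))).mul
      (hf.comp continuous_snd)
  · exact (hf.comp continuous_snd).smul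
      ((hfd.comp (by fun_prop : Continuous fun w : V3 × Phase => (w.1, w.2.1))).clm_comp
        continuous_const)
  · intro q z
    have h := HasFDerivAt.comp (g := fun w : V3 × V3 => K w.1 w.2) (f := fun x => (x, z.1)) q
      ((hK.differentiable one_ne_zero) (q, z.1)).hasFDerivAt
      (hasFDerivAt_prodMk_left (𝕜 := ℝ) q z.1)
    exact h.mul_const (f z)

theorem pq_eq_fderiv {F : Phase → ℝ} (hF : Differentiable ℝ F) (i : Fin 3) (z : Phase) :
    pq i F z = fderiv ℝ F z (Pi.single i 1, 0) := by
  have h1 : HasDerivAt (fun s : ℝ => ((Function.update z.1 i s, z.2) : Phase))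
      (Pi.single i 1, 0) (z.1 i) :=
    (hasDerivAt_update z.1 i (z.1 i)).prodMk (hasDerivAt_const _ _)
  have h2 : HasFDerivAt F (fderiv ℝ F z) (Function.update z.1 i (z.1 i), z.2) := by
    rw [Function.update_eq_self]
    exact (hF z).hasFDerivAt
  exact (h2.comp_hasDerivAt (z.1 i) h1).deriv

theorem pp_eq_fderiv {F : Phase → ℝ} (hF : Differentiable ℝ F) (i : Fin 3) (z : Phase) :
    pp i F z = fderiv ℝ F z (0, Pi.single i 1) := by
  have h1 : HasDerivAt (fun s : ℝ => ((z.1, Function.update z.2 i s) : Phase))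
      (0, Pi.single i 1) (z.2 i) :=
    (hasDerivAt_const _ _).prodMk (hasDerivAt_update z.2 i (z.2 i))
  have h2 : HasFDerivAt F (fderiv ℝ F z) (z.1, Function.update z.2 i (z.2 i)) := by
    rw [Function.update_eq_self]
    exact (hF z).hasFDerivAt
  exact (h2.comp_hasDerivAt (z.2 i) h1).deriv

/-- Integration by parts for a compactly supported `C¹` function against a `C¹` function,
together with integrability of both integrands. -/
theorem integral_mul_fderiv_of_hasCompactSupport {P h : Phase → ℝ} (hP : ContDiff ℝ 1 P)
    (hc : HasCompactSupport P) (hh : ContDiff ℝ 1 h) (v : Phase) :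
    Integrable (fun z => P z * fderiv ℝ h z v) ∧ Integrable (fun z => fderiv ℝ P z v * h z) ∧
      ∫ z, P z * fderiv ℝ h z v = - ∫ z, fderiv ℝ P z v * h z := by
  have hP' : Continuous fun z => fderiv ℝ P z v :=
    (hP.continuous_fderiv one_ne_zero).clm_apply continuous_const
  have hh' : Continuous fun z => fderiv ℝ h z v :=
    (hh.continuous_fderiv one_ne_zero).clm_apply continuous_const
  have h1 : Integrable (fun z => P z * fderiv ℝ h z v) :=
    (hP.continuous.mul hh').integrable_of_hasCompactSupport hc.mul_right
  have h2 : Integrable (fun z => fderiv ℝ P z v * h z) :=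
    (hP'.mul hh.continuous).integrable_of_hasCompactSupport (hc.fderiv_apply ℝ v).mul_right
  have h3 : Integrable (fun z => P z * h z) :=
    (hP.continuous.mul hh.continuous).integrable_of_hasCompactSupport hc.mul_right
  have : (volume : Measure Phase).IsAddHaarMeasure :=
    Measure.prod.instIsAddHaarMeasure (volume : Measure V3) (volume : Measure V3)
  exact ⟨h1, h2, integral_mul_fderiv_eq_neg_fderiv_mul_of_integrable h2 h1 h3
    (fun z _ => hP.differentiable one_ne_zero z) (fun z _ => hh.differentiable one_ne_zero z)⟩

/-- the density form and the momentum form of the Lie–Poisson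
Hamiltonian agree:
`∫ (|p|²/(2m)) f dμ + (e²/2) ∬ f K f = ∫ Σᵢ (Πⁱ ∂h_f/∂qᵢ − Πᵢ ∂h_f/∂pᵢ) dμ`
where `f` is the density of `Π`, `φ_f(q) = e ∫ K(q,q') f(z') dμ'` and
`h_f = |p|²/(2m) + (e/2) φ_f`. -/
theorem density_and_momentum_hamiltonians_agree
    (m e : ℝ) (hm : 0 < m)
    (K : V3 → V3 → ℝ)
    (hK : ContDiff ℝ 1 (fun w : V3 × V3 => K w.1 w.2))
    (hKsymm : ∀ q q', K q q' = K q' q)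
    (Pq Pp : Fin 3 → Phase → ℝ)
    (hPq : ∀ i, ContDiff ℝ (⊤ : ℕ∞) (Pq i)) (hPp : ∀ i, ContDiff ℝ (⊤ : ℕ∞) (Pp i))
    (hcq : ∀ i, HasCompactSupport (Pq i)) (hcp : ∀ i, HasCompactSupport (Pp i))
    (f : Phase → ℝ)
    (hf : ∀ z, f z = ∑ i : Fin 3, (pp i (Pq i) z - pq i (Pp i) z))
    (φf : V3 → ℝ)
    (hφf : ∀ q, φf q = e * ∫ z : Phase, K q z.1 * f z)
    (hfz : Phase → ℝ)
    (hhf : ∀ z, hfz z = (∑ i : Fin 3, (z.2 i) ^ 2) / (2 * m) + (e / 2) * φf z.1) :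
    (∫ z : Phase, ((∑ i : Fin 3, (z.2 i) ^ 2) / (2 * m)) * f z)
        + (e ^ 2 / 2) * ∫ w : Phase × Phase, f w.1 * K w.1.1 w.2.1 * f w.2
      = ∫ z : Phase,
          ∑ i : Fin 3, (Pp i z * pq i hfz z - Pq i z * pp i hfz z) := by
  have hq1 : ∀ i, ContDiff ℝ 1 (Pq i) := fun i => (hPq i).of_le (by exact_mod_cast le_top)
  have hp1 : ∀ i, ContDiff ℝ 1 (Pp i) := fun i => (hPp i).of_le (by exact_mod_cast le_top)
  have hfeq : f = fun z => ∑ i : Fin 3, (fderiv ℝ (Pq i) z (0, Pi.single i 1)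
      - fderiv ℝ (Pp i) z (Pi.single i 1, 0)) := by
    funext z
    rw [hf]
    refine Finset.sum_congr rfl fun i _ => ?_
    rw [pp_eq_fderiv ((hq1 i).differentiable one_ne_zero),
      pq_eq_fderiv ((hp1 i).differentiable one_ne_zero)]
  have hfcont : Continuous f := by
    rw [hfeq]
    exact continuous_finsetSum _ fun i _ =>
      (((hq1 i).continuous_fderiv one_ne_zero).clm_apply continuous_const).sub
        (((hp1 i).continuous_fderiv one_ne_zero).clm_apply continuous_const)
  have hfc : HasCompactSupport f := by
    have hi : ∀ i : Fin 3, HasCompactSupport fun z => fderiv ℝ (Pq i) z (0, Pi.single i 1)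
        - fderiv ℝ (Pp i) z (Pi.single i 1, 0) := fun i =>
      ((hcq i).fderiv_apply ℝ _).sub ((hcp i).fderiv_apply ℝ _)
    rw [hfeq]
    simp only [Fin.sum_univ_three]
    exact ((hi 0).add (hi 1)).add (hi 2)
  have hφ1 : ContDiff ℝ 1 φf := by
    rw [funext hφf]
    exact contDiff_const.mul (contDiff_one_integral_kernel_mul hK hfcont hfc)
  have hkin : ContDiff ℝ 1 fun z : Phase => (∑ i : Fin 3, (z.2 i) ^ 2) / (2 * m) := by
    fun_prop
  have hpot : ContDiff ℝ 1 fun z : Phase => (e / 2) * φf z.1 :=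
    contDiff_const.mul (hφ1.comp contDiff_fst)
  have hh1 : ContDiff ℝ 1 hfz := by
    rw [funext hhf]
    exact hkin.add hpot
  have hhd : Differentiable ℝ hfz := hh1.differentiable one_ne_zero
  have hRHS : ∫ z : Phase, ∑ i : Fin 3, (Pp i z * pq i hfz z - Pq i z * pp i hfz z)
      = ∫ z : Phase, hfz z * f z := by
    simp_rw [pq_eq_fderiv hhd, pp_eq_fderiv hhd]
    have hP := fun i => integral_mul_fderiv_of_hasCompactSupport (hp1 i) (hcp i) hh1
      (Pi.single i 1, 0)
    have hQ := fun i => integral_mul_fderiv_of_hasCompactSupport (hq1 i) (hcq i) hh1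
      (0, Pi.single i 1)
    rw [integral_finsetSum _ fun i _ => by exact (hP i).1.sub (hQ i).1]
    have hexp : ∀ z, hfz z * f z = ∑ i : Fin 3, (fderiv ℝ (Pq i) z (0, Pi.single i 1) * hfz z
        - fderiv ℝ (Pp i) z (Pi.single i 1, 0) * hfz z) := by
      intro z
      rw [hfeq, Finset.mul_sum]
      exact Finset.sum_congr rfl fun i _ => by ring
    simp_rw [hexp]
    rw [integral_finsetSum _ fun i _ => by exact (hQ i).2.1.sub (hP i).2.1]
    refine Finset.sum_congr rfl fun i _ => ?_
    rw [integral_sub (hP i).1 (hQ i).1, integral_sub (hQ i).2.1 (hP i).2.1, (hP i).2.2,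
      (hQ i).2.2]
    ring
  have hdouble : (e ^ 2 / 2) * ∫ w : Phase × Phase, f w.1 * K w.1.1 w.2.1 * f w.2
      = ∫ z : Phase, ((e / 2) * φf z.1) * f z := by
    have hKc : Continuous fun w : Phase × Phase => K w.1.1 w.2.1 :=
      hK.continuous.comp (by fun_prop : Continuous fun w : Phase × Phase => (w.1.1, w.2.1))
    have hint : Integrable (fun w : Phase × Phase => f w.1 * K w.1.1 w.2.1 * f w.2)
        ((volume : Measure Phase).prod volume) := by
      refine Continuous.integrable_of_hasCompactSupport
        (((hfcont.comp continuous_fst).mul hKc).mul (hfcont.comp continuous_snd)) ?_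
      refine HasCompactSupport.intro (hfc.prod hfc) fun w hw => ?_
      by_cases h1 : w.1 ∈ tsupport f
      · have h2 : w.2 ∉ tsupport f := fun h2 => hw ⟨h1, h2⟩
        rw [image_eq_zero_of_notMem_tsupport h2, mul_zero]
      · rw [image_eq_zero_of_notMem_tsupport h1, zero_mul, zero_mul]
    rw [Measure.volume_eq_prod, integral_prod _ hint, ← integral_const_mul]
    refine integral_congr_ae (Filter.Eventually.of_forall fun z => ?_)
    simp only [hφf, mul_assoc, integral_const_mul]
    ring
  rw [hRHS, hdouble, ← integral_add
    (by exact (hkin.continuous.mul hfcont).integrable_of_hasCompactSupport hfc.mul_left)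
    (by exact (hpot.continuous.mul hfcont).integrable_of_hasCompactSupport hfc.mul_left)]
  refine integral_congr_ae (Filter.Eventually.of_forall fun z => ?_)
  simp only [hhf]
  ring
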